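/- Let q be a complex number with q ≠ 0 and q^j ≠ 1 for all 1 ≤ j ≤ m+n, where m, n ≥ 0 are integers. Then ∑_{k=1}^{n} (−1)^k · q^{k(k+1)/2} / ( (q;q)_k · (q;q)_{n-k} · (q^k;q)_{m+1} ) − ∑_{k=1}^{m} (−1)^k · q^{k(k+1)/2} / ( (q;q)_k · (q;q)_{m-k} · (q^k;q)_{n+1} ) = ( ∑_{k=1}^{m} q^k/(1−q^k) − ∑_{k=1}^{n} q^k/(1−q^k) ) / ( (q;q)_m · (q;q)_n ). -/

import Mathlib

open Finset

/-- The q-Pochhammer symbol `(x;q)_N = ∏_{j=0}^{N-1} (1 - x q^j)`. -/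
noncomputable def qPoch (q x : ℂ) (N : ℕ) : ℂ := ∏ j ∈ Finset.range N, (1 - x * q ^ j)

/-- The coefficient of `1 / (1 - x q^k)` in the partial fraction expansion of `1 / (x;q)_{n+1}`. -/
noncomputable def qPochCoeff (q : ℂ) (n k : ℕ) : ℂ :=
  (-1 : ℂ) ^ k * q ^ (k * (k + 1) / 2) / (qPoch q q k * qPoch q q (n - k))

theorem qPoch_zero (q x : ℂ) : qPoch q x 0 = 1 := by
  simp [qPoch]

theorem qPoch_succ (q x : ℂ) (N : ℕ) : qPoch q x (N + 1) = qPoch q x N * (1 - x * q ^ N) :=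
  Finset.prod_range_succ _ _

theorem qPoch_succ' (q x : ℂ) (N : ℕ) :
    qPoch q x (N + 1) = (1 - x) * qPoch q (x * q) N := by
  simp only [qPoch, Finset.prod_range_succ', pow_zero, mul_one, pow_succ']
  rw [mul_comm]
  simp only [mul_assoc]

theorem qPoch_self_succ (q : ℂ) (N : ℕ) :
    qPoch q q (N + 1) = qPoch q q N * (1 - q ^ (N + 1)) := by
  rw [qPoch_succ, pow_succ']

theorem qPoch_ne_zero {q x : ℂ} {N : ℕ} (h : ∀ j < N, x * q ^ j ≠ 1) : qPoch q x N ≠ 0 :=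
  Finset.prod_ne_zero_iff.mpr fun j hj => sub_ne_zero.mpr (h j (Finset.mem_range.mp hj)).symm

theorem qPoch_self_ne_zero {q : ℂ} {N : ℕ} (h : ∀ j, 1 ≤ j → j ≤ N → q ^ j ≠ 1) :
    qPoch q q N ≠ 0 :=
  qPoch_ne_zero fun j hj => by rw [← pow_succ']; exact h _ (by omega) (by omega)

theorem qPochCoeff_zero_right (q : ℂ) (n : ℕ) : qPochCoeff q n 0 = 1 / qPoch q q n := by
  simp [qPochCoeff, qPoch_zero]

theorem qPochCoeff_succ_left {q : ℂ} {n k : ℕ} (hk : k ≤ n)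
    (h : ∀ j, 1 ≤ j → j ≤ n + 1 → q ^ j ≠ 1) :
    (1 - q ^ (n + 1 - k)) * qPochCoeff q (n + 1) k = qPochCoeff q n k := by
  obtain ⟨d, rfl⟩ := Nat.exists_eq_add_of_le hk
  have e1 : k + d + 1 - k = d + 1 := by omega
  have e2 : k + d - k = d := by omega
  have hk0 : qPoch q q k ≠ 0 := qPoch_self_ne_zero fun j h1 h2 => h j h1 (by omega)
  have hd0 : qPoch q q d ≠ 0 := qPoch_self_ne_zero fun j h1 h2 => h j h1 (by omega)
  have hd : 1 - q ^ (d + 1) ≠ 0 := sub_ne_zero.mpr (h _ (by omega) (by omega)).symm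
  rw [qPochCoeff, qPochCoeff, e1, e2, qPoch_self_succ]
  field_simp

theorem qPochCoeff_succ_succ {q : ℂ} {n k : ℕ} (hk : k ≤ n)
    (h : ∀ j, 1 ≤ j → j ≤ n + 1 → q ^ j ≠ 1) :
    (1 - q ^ (k + 1)) * qPochCoeff q (n + 1) (k + 1) = -q ^ (k + 1) * qPochCoeff q n k := by
  have hk0 : qPoch q q k ≠ 0 := qPoch_self_ne_zero fun j h1 h2 => h j h1 (by omega)
  have hd0 : qPoch q q (n - k) ≠ 0 := qPoch_self_ne_zero fun j h1 h2 => h j h1 (by omega)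
  have hd : 1 - q ^ (k + 1) ≠ 0 := sub_ne_zero.mpr (h _ (by omega) (by omega)).symm
  have e : (k + 1) * (k + 1 + 1) / 2 = k * (k + 1) / 2 + (k + 1) := by
    rw [show (k + 1) * (k + 1 + 1) = k * (k + 1) + (k + 1) * 2 by ring,
      Nat.add_mul_div_right _ _ two_pos]
  rw [qPochCoeff, qPochCoeff, Nat.add_sub_add_right, qPoch_self_succ, e,
    pow_add q (k * (k + 1) / 2), pow_succ (-1)]
  generalize q ^ (k + 1) = a at hd ⊢
  field_simp

theorem one_sub_mul_sum_qPochCoeff {q : ℂ} {n : ℕ} (h : ∀ j, 1 ≤ j → j ≤ n + 1 → q ^ j ≠ 1)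
    (f : ℕ → ℂ) :
    (1 - q ^ (n + 1)) * ∑ k ∈ range (n + 2), qPochCoeff q (n + 1) k * f k =
      ∑ k ∈ range (n + 1), qPochCoeff q n k * f k
        - q ^ (n + 1) * ∑ k ∈ range (n + 1), qPochCoeff q n k * f (k + 1) := by
  have split : (1 - q ^ (n + 1)) * ∑ k ∈ range (n + 2), qPochCoeff q (n + 1) k * f k =
      ∑ k ∈ range (n + 2), (1 - q ^ (n + 1 - k)) * qPochCoeff q (n + 1) k * f k
        + ∑ k ∈ range (n + 2),
            q ^ (n + 1 - k) * ((1 - q ^ k) * qPochCoeff q (n + 1) k) * f k := by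
    rw [Finset.mul_sum, ← Finset.sum_add_distrib]
    refine Finset.sum_congr rfl fun k hk => ?_
    have : q ^ (n + 1) = q ^ (n + 1 - k) * q ^ k := by
      rw [← pow_add, Nat.sub_add_cancel (Nat.lt_succ_iff.mp (Finset.mem_range.mp hk))]
    rw [this]
    ring
  rw [split, Finset.sum_range_succ, Finset.sum_range_succ' _ (n + 1), sub_eq_add_neg (∑ k ∈ range (n + 1), _),
    Finset.mul_sum, ← Finset.sum_neg_distrib]
  simp only [Nat.sub_self, pow_zero, sub_self, zero_mul, mul_zero, add_zero]
  congr 1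
  · refine Finset.sum_congr rfl fun k hk => ?_
    rw [qPochCoeff_succ_left (Nat.lt_succ_iff.mp (Finset.mem_range.mp hk)) h]
  · refine Finset.sum_congr rfl fun k hk => ?_
    have hk : k ≤ n := Nat.lt_succ_iff.mp (Finset.mem_range.mp hk)
    have : q ^ (n + 1) = q ^ (n + 1 - (k + 1)) * q ^ (k + 1) := by
      rw [← pow_add]
      congr 1
      omega
    rw [qPochCoeff_succ_succ hk h, this]
    ring

/-- Partial fraction expansion of `1 / (x;q)_{n+1}`. -/
theorem sum_qPochCoeff_div {q : ℂ} {n : ℕ} (h : ∀ j, 1 ≤ j → j ≤ n → q ^ j ≠ 1) {x : ℂ}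
    (hx : ∀ j ≤ n, x * q ^ j ≠ 1) :
    ∑ k ∈ range (n + 1), qPochCoeff q n k * (1 / (1 - x * q ^ k)) = 1 / qPoch q x (n + 1) := by
  induction n generalizing x with
  | zero => simp [qPochCoeff, qPoch]
  | succ n ih =>
    have hn : 1 - q ^ (n + 1) ≠ 0 := sub_ne_zero.mpr (h _ (by omega) le_rfl).symm
    have h' : ∀ j, 1 ≤ j → j ≤ n → q ^ j ≠ 1 := fun j h1 h2 => h j h1 (by omega)
    have hxq : ∀ j ≤ n, x * q * q ^ j ≠ 1 := fun j hj => by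
      rw [mul_assoc, ← pow_succ']
      exact hx _ (by omega)
    have hshift := ih h' hxq
    simp only [mul_assoc x q, ← pow_succ'] at hshift
    have h0 : 1 - x ≠ 0 := sub_ne_zero.mpr (by simpa using (hx 0 (by omega)).symm)
    have hlast : 1 - x * q ^ (n + 1) ≠ 0 := sub_ne_zero.mpr (hx _ le_rfl).symm
    have hfst : 1 / qPoch q x (n + 1) = (1 - x * q ^ (n + 1)) / qPoch q x (n + 2) := by
      rw [qPoch_succ q x (n + 1), div_mul_cancel_right₀ hlast, one_div]
    have hsnd : 1 / qPoch q (x * q) (n + 1) = (1 - x) / qPoch q x (n + 2) := by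
      rw [qPoch_succ' q x (n + 1), div_mul_cancel_left₀ h0, one_div]
    apply mul_left_cancel₀ hn
    rw [one_sub_mul_sum_qPochCoeff h, ih h' fun j hj => hx j (by omega), hshift, hfst, hsnd]
    ring

/-- Van Hamme's identity; the summand at `k = 0` vanishes because `1 / 0 = 0`. -/
theorem sum_qPochCoeff_div_one_sub_pow {q : ℂ} {n : ℕ} (h : ∀ j, 1 ≤ j → j ≤ n → q ^ j ≠ 1) :
    ∑ k ∈ range (n + 1), qPochCoeff q n k * (1 / (1 - q ^ k)) =
      -(∑ k ∈ Icc 1 n, q ^ k / (1 - q ^ k)) / qPoch q q n := by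
  induction n with
  | zero => simp
  | succ n ih =>
    have hn : 1 - q ^ (n + 1) ≠ 0 := sub_ne_zero.mpr (h _ (by omega) le_rfl).symm
    have h' : ∀ j, 1 ≤ j → j ≤ n → q ^ j ≠ 1 := fun j h1 h2 => h j h1 (by omega)
    have hp : qPoch q q n ≠ 0 := qPoch_self_ne_zero h'
    have hpf := sum_qPochCoeff_div h' (x := q) fun j hj => by
      rw [← pow_succ']
      exact h _ (by omega) (by omega)
    simp only [← pow_succ'] at hpf
    apply mul_left_cancel₀ hn
    rw [one_sub_mul_sum_qPochCoeff h, ih h', hpf, Finset.sum_Icc_succ_top (by omega),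
      qPoch_self_succ]
    field_simp
    ring

theorem sum_div_qPoch_eq {q : ℂ} {m n : ℕ} (h : ∀ j, 1 ≤ j → j ≤ m + n → q ^ j ≠ 1) :
    ∑ k ∈ Icc 1 n, (-1 : ℂ) ^ k * q ^ (k * (k + 1) / 2)
        / (qPoch q q k * qPoch q q (n - k) * qPoch q (q ^ k) (m + 1)) =
      ∑ k ∈ range (n + 1), ∑ j ∈ range (m + 1),
          qPochCoeff q n k * qPochCoeff q m j * (1 / (1 - q ^ (k + j)))
        + (∑ k ∈ Icc 1 m, q ^ k / (1 - q ^ k)) / (qPoch q q m * qPoch q q n) := by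
  have hm : ∀ j, 1 ≤ j → j ≤ m → q ^ j ≠ 1 := fun j h1 h2 => h j h1 (by omega)
  have hzero : ∑ j ∈ range (m + 1),
      qPochCoeff q n 0 * qPochCoeff q m j * (1 / (1 - q ^ (0 + j))) =
      -((∑ k ∈ Icc 1 m, q ^ k / (1 - q ^ k)) / (qPoch q q m * qPoch q q n)) := by
    simp only [mul_assoc, zero_add]
    rw [← Finset.mul_sum, sum_qPochCoeff_div_one_sub_pow hm, qPochCoeff_zero_right,
      div_mul_div_comm, one_mul, neg_div, mul_comm (qPoch q q n)]
  rw [Finset.range_eq_Ico, Finset.sum_eq_sum_Ico_succ_bot n.succ_pos, hzero,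
    neg_add_cancel_comm, zero_add, Nat.succ_eq_add_one, Finset.Ico_add_one_right_eq_Icc]
  refine Finset.sum_congr rfl fun k hk => ?_
  obtain ⟨hk1, hkn⟩ := Finset.mem_Icc.mp hk
  have hpf := sum_qPochCoeff_div hm (x := q ^ k) fun j hj => by
    rw [← pow_add]
    exact h _ (by omega) (by omega)
  simp only [← pow_add] at hpf
  simp only [mul_assoc (qPochCoeff q n k)]
  rw [← Finset.mul_sum, hpf, qPochCoeff, div_mul_div_comm, mul_one]

theorem stmt_18 (q : ℂ) (hq : q ≠ 0) (m n : ℕ)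
    (hq1 : ∀ j : ℕ, 1 ≤ j → j ≤ m + n → q ^ j ≠ 1) :
    (∑ k ∈ Finset.Icc 1 n,
        (-1 : ℂ) ^ k * q ^ (k * (k + 1) / 2)
          / (qPoch q q k * qPoch q q (n - k) * qPoch q (q ^ k) (m + 1)))
      - (∑ k ∈ Finset.Icc 1 m,
          (-1 : ℂ) ^ k * q ^ (k * (k + 1) / 2)
            / (qPoch q q k * qPoch q q (m - k) * qPoch q (q ^ k) (n + 1)))
      = ((∑ k ∈ Finset.Icc 1 m, q ^ k / (1 - q ^ k))
          - ∑ k ∈ Finset.Icc 1 n, q ^ k / (1 - q ^ k))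
          / (qPoch q q m * qPoch q q n) := by
  rw [sum_div_qPoch_eq hq1, sum_div_qPoch_eq (m := n) (n := m) (by rwa [add_comm n m]),
    Finset.sum_comm, mul_comm (qPoch q q n)]
  simp only [mul_comm (qPochCoeff q n _), add_comm]
  ring
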